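/- Let E be a finite-dimensional real vector space, Q a quadratic form on E, and A a linear endomorphism of E such that x ↦ DQ(x)[Ax] is negative for every x ≠ 0. Then E decomposes as a direct sum E = E⁺ ⊕ E⁻ of A-invariant subspaces such that every eigenvalue of the complexification of the restriction A|E⁺ has positive real part and every eigenvalue of the complexification of A|E⁻ has negative real part; moreover Q is negative definite on E⁺, Q is positive definite on E⁻, and dim E⁺ equals the index of Q (the maximal dimension of a subspace of E on which Q is negative definite). -/

import Mathlib

open Module
open Polynomial TensorProduct

section ComplexForms

variable {V : Type*} [AddCommGroup V] [Module ℝ V] [Module ℂ V]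

lemma LinearMap.BilinForm.apply_I_smul_eq_neg {h : LinearMap.BilinForm ℝ V}
    (hI : ∀ x y, h (Complex.I • x) (Complex.I • y) = h x y) (x y : V) :
    h (Complex.I • x) y = -h x (Complex.I • y) := by
  rw [← hI x (Complex.I • y), smul_smul Complex.I Complex.I y]
  simp

lemma LinearMap.BilinForm.apply_self_I_smul {h : LinearMap.BilinForm ℝ V}
    (hs : ∀ x y, h x y = h y x) (hI : ∀ x y, h (Complex.I • x) (Complex.I • y) = h x y) (x : V) :
    h x (Complex.I • x) = 0 := by
  linarith [h.apply_I_smul_eq_neg hI x x, hs x (Complex.I • x)]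

variable [IsScalarTower ℝ ℂ V]

/-- The real part of a Hermitian form, expanded in a complex multiple of the right argument. -/
lemma LinearMap.BilinForm.apply_complex_smul_right (h : LinearMap.BilinForm ℝ V) (c : ℂ)
    (x y : V) : h x (c • y) = c.re * h x y + c.im * h x (Complex.I • y) := by
  have hc : c • y = c.re • y + c.im • Complex.I • y := by
    conv_lhs => rw [← Complex.re_add_im c]
    rw [add_smul, mul_smul, ← Complex.coe_algebraMap, algebraMap_smul, algebraMap_smul]
  simp [hc]

lemma LinearMap.BilinForm.apply_eigenvector {h : LinearMap.BilinForm ℝ V}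
    (hs : ∀ x y, h x y = h y x) (hI : ∀ x y, h (Complex.I • x) (Complex.I • y) = h x y)
    {T : End ℂ V} {μ : ℂ} {v : V} (hv : T.HasEigenvector μ v) :
    h v (T v) = μ.re * h v v := by
  rw [hv.apply_eq_smul, h.apply_complex_smul_right, h.apply_self_I_smul hs hI]
  ring

/-- Lyapunov's theorem for the real part `h` of a Hermitian form: if `h x (T x) < 0` for `x ≠ 0`
and the spectrum of `T` lies in the open right half-plane, then `h` is negative definite. -/
theorem LinearMap.BilinForm.neg_of_apply_neg_of_re_pos [FiniteDimensional ℂ V]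
    {h : LinearMap.BilinForm ℝ V}
    (hs : ∀ x y, h x y = h y x) (hI : ∀ x y, h (Complex.I • x) (Complex.I • y) = h x y)
    {T : End ℂ V} (hT : ∀ x, x ≠ 0 → h x (T x) < 0)
    (hre : ∀ μ, T.HasEigenvalue μ → 0 < μ.re) (x : V) (hx : x ≠ 0) : h x x < 0 := by
  induction hn : finrank ℂ V using Nat.strong_induction_on generalizing V with
  | _ n ih =>
  subst hn
  have : Nontrivial V := ⟨x, 0, hx⟩
  obtain ⟨l, hl⟩ := End.exists_eigenvalue T
  obtain ⟨v, hv⟩ := hl.exists_hasEigenvector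
  have hvv : h v v < 0 := by
    have h₁ := hT v hv.2
    rw [h.apply_eigenvector hs hI hv] at h₁
    exact (pos_iff_neg_of_mul_neg h₁).1 (hre l hl)
  let φ : Dual ℂ V := Dual.extendRCLike (h v)
  have hφ (y : V) : φ y = h v y - Complex.I * h v (Complex.I • y) :=
    Dual.extendRCLike_apply (h v) y
  have hφv : φ v ≠ 0 := by
    rw [hφ, h.apply_self_I_smul hs hI]
    simpa using hvv.ne
  have horth (y : V) (hy : φ y = 0) (c : ℂ) : h y (c • v) = 0 := by
    rw [hφ, Complex.ext_iff] at hy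
    simp only [Complex.sub_re, Complex.ofReal_re, Complex.mul_re, Complex.I_re, Complex.I_im,
      Complex.ofReal_im, Complex.sub_im, Complex.mul_im, Complex.zero_re, Complex.zero_im] at hy
    rw [h.apply_complex_smul_right, hs y v, hs y, h.apply_I_smul_eq_neg hI]
    have h₁ : h v y = 0 := by linarith [hy.1]
    have h₂ : h v (Complex.I • y) = 0 := by linarith [hy.2]
    simp [h₁, h₂]
  -- the compression of `T` to the orthogonal complement of `v`
  let W : Submodule ℂ V := LinearMap.ker φ
  let π : V →ₗ[ℂ] W := LinearMap.codRestrict W (LinearMap.id - ((φ v)⁻¹ • φ).smulRight v) <| by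
    intro y
    simp [W, hφv, mul_right_comm]
  have hπ (y : V) : (π y : V) = y - ((φ v)⁻¹ * φ y) • v := rfl
  let S : End ℂ W := π ∘ₗ T ∘ₗ W.subtype
  have hS (w : W) : (S w : V) = T w - ((φ v)⁻¹ * φ (T w)) • v := rfl
  let k : LinearMap.BilinForm ℝ W :=
    h.compl₁₂ (W.subtype.restrictScalars ℝ) (W.subtype.restrictScalars ℝ)
  have hk (y z : W) : k y z = h y z := rfl
  have hlt : finrank ℂ W < finrank ℂ V :=
    Submodule.finrank_lt fun htop ↦ hφv (htop.ge (Submodule.mem_top (x := v)))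
  have hneg (w : W) (hw : w ≠ 0) : h w w < 0 := by
    refine ih _ hlt (h := k) (fun y z ↦ hs y z) (fun y z ↦ hI y z) (T := S) ?_ ?_ w hw rfl
    · intro y hy
      rw [hk, hS, map_sub, horth y y.2, sub_zero]
      exact hT y (by simpa using hy)
    · intro μ hμ
      by_cases hμl : μ = l
      · exact hμl ▸ hre l hl
      obtain ⟨y, hy⟩ := hμ.exists_hasEigenvector
      set c := (φ v)⁻¹ * φ (T y) with hc
      have hTy : T y = μ • (y : V) + c • v := by
        have := congrArg Subtype.val hy.apply_eq_smul
        rw [hS, sub_eq_iff_eq_add] at this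
        exact this
      have hsub : μ - l ≠ 0 := sub_ne_zero.2 hμl
      refine hre μ (End.hasEigenvalue_of_hasEigenvector (x := (y : V) + (c / (μ - l)) • v) ?_)
      refine End.hasEigenvector_iff.2 ⟨End.mem_eigenspace_iff.2 ?_, ?_⟩
      · rw [map_add, map_smul, hTy, hv.apply_eq_smul, smul_add, add_assoc, smul_smul, smul_smul,
          ← add_smul]
        congr 2
        field_simp
        ring
      · intro h0
        have h₁ := congrArg φ h0
        have hy0 : φ y = 0 := y.2
        rw [map_add, map_smul, hy0, map_zero, zero_add, smul_eq_zero, or_iff_left hφv] at h₁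
        rw [h₁, zero_smul, add_zero] at h0
        exact hy.2 (Subtype.ext h0)
  set c := (φ v)⁻¹ * φ x
  have hdecomp : x = (π x : V) + c • v := by rw [hπ]; simp [c]
  have hcc : h (c • v) (c • v) = (c.re ^ 2 + c.im ^ 2) * h v v := by
    rw [h.apply_complex_smul_right, hs _ v, h.apply_complex_smul_right,
      h.apply_self_I_smul hs hI, hs _ (Complex.I • v), h.apply_complex_smul_right, hI,
      hs (Complex.I • v) v, h.apply_self_I_smul hs hI]
    ring
  have hxx : h x x = h (π x) (π x) + (c.re ^ 2 + c.im ^ 2) * h v v := by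
    conv_lhs => rw [hdecomp]
    rw [map_add, map_add, LinearMap.add_apply, LinearMap.add_apply, hcc, hs (c • v),
      horth _ (π x).2]
    ring
  rw [hxx]
  by_cases hπx : π x = 0
  · have hc0 : c ≠ 0 := by
      intro hc0
      rw [hπx, hc0, zero_smul, add_zero] at hdecomp
      exact hx hdecomp
    have hpos : 0 < c.re ^ 2 + c.im ^ 2 := by
      have := Complex.normSq_pos.2 hc0
      rw [Complex.normSq_apply] at this
      linarith
    rw [hπx]
    simpa using mul_neg_of_pos_of_neg hpos hvv
  · have := hneg _ hπx
    nlinarith [sq_nonneg c.re, sq_nonneg c.im]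

end ComplexForms

section Complexification

variable {W : Type*} [AddCommGroup W] [Module ℝ W]

/-- The real part of the Hermitian extension to `ℂ ⊗ W` of a real bilinear form on `W`. -/
noncomputable def LinearMap.BilinForm.complexify (B : LinearMap.BilinForm ℝ W) :
    LinearMap.BilinForm ℝ (ℂ ⊗[ℝ] W) :=
  LinearMap.BilinForm.tmul (innerₗ ℂ) B

lemma LinearMap.BilinForm.complexify_tmul (B : LinearMap.BilinForm ℝ W) (z w : ℂ) (x y : W) :
    B.complexify (z ⊗ₜ x) (w ⊗ₜ y) = B x y * inner ℝ z w := rfl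

lemma LinearMap.BilinForm.complexify_symm {B : LinearMap.BilinForm ℝ W}
    (hs : ∀ x y, B x y = B y x) (x y : ℂ ⊗[ℝ] W) : B.complexify x y = B.complexify y x :=
  (LinearMap.IsSymm.tmul (B₁ := innerₗ ℂ) (B₂ := B) ⟨fun z w ↦ real_inner_comm w z⟩ ⟨hs⟩).eq x y

lemma LinearMap.BilinForm.complexify_I_smul (B : LinearMap.BilinForm ℝ W) (x y : ℂ ⊗[ℝ] W) :
    B.complexify (Complex.I • x) (Complex.I • y) = B.complexify x y := by
  induction x with
  | zero => simp
  | add x₁ x₂ h₁ h₂ => simp only [smul_add, map_add, LinearMap.add_apply, h₁, h₂]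
  | tmul z x =>
    induction y with
    | zero => simp
    | add y₁ y₂ h₁ h₂ => simp only [smul_add, map_add, h₁, h₂]
    | tmul w y =>
      simp only [smul_tmul', complexify_tmul, Complex.inner, smul_eq_mul, map_mul, Complex.conj_I]
      congr 2
      linear_combination (-w * (starRingEnd ℂ) z) * Complex.I_mul_I

lemma exists_eq_one_tmul_add_I_tmul (z : ℂ ⊗[ℝ] W) :
    ∃ x y : W, z = (1 : ℂ) ⊗ₜ[ℝ] x + Complex.I ⊗ₜ[ℝ] y := by
  induction z with
  | zero => exact ⟨0, 0, by simp⟩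
  | add z₁ z₂ h₁ h₂ =>
    obtain ⟨x₁, y₁, rfl⟩ := h₁
    obtain ⟨x₂, y₂, rfl⟩ := h₂
    exact ⟨x₁ + x₂, y₁ + y₂, by simp only [tmul_add]; abel⟩
  | tmul c x =>
    refine ⟨c.re • x, c.im • x, ?_⟩
    rw [← smul_tmul, ← smul_tmul, ← add_tmul]
    congr 1
    apply Complex.ext <;> simp

lemma LinearMap.BilinForm.complexify_apply_baseChange_neg {B : LinearMap.BilinForm ℝ W}
    {T : End ℝ W} (hT : ∀ x, x ≠ 0 → B x (T x) < 0) (z : ℂ ⊗[ℝ] W) (hz : z ≠ 0) :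
    B.complexify z (T.baseChange ℂ z) < 0 := by
  obtain ⟨x, y, rfl⟩ := exists_eq_one_tmul_add_I_tmul z
  have heq : B.complexify ((1 : ℂ) ⊗ₜ[ℝ] x + Complex.I ⊗ₜ[ℝ] y)
      (T.baseChange ℂ ((1 : ℂ) ⊗ₜ[ℝ] x + Complex.I ⊗ₜ[ℝ] y)) = B x (T x) + B y (T y) := by
    simp [complexify_tmul, Complex.inner]
  have hle (u : W) : B u (T u) ≤ 0 := by
    by_cases hu : u = 0
    · simp [hu]
    · exact (hT u hu).le
  rw [heq]
  by_cases hx : x = 0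
  · have hy : y ≠ 0 := by
      rintro rfl
      simp [hx] at hz
    linarith [hle x, hT y hy]
  · linarith [hT x hx, hle y]

/-- Lyapunov's theorem for a real symmetric bilinear form. -/
theorem LinearMap.BilinForm.neg_of_apply_neg_of_baseChange_re_pos [FiniteDimensional ℝ W]
    {B : LinearMap.BilinForm ℝ W} (hs : ∀ x y, B x y = B y x) {T : End ℝ W}
    (hT : ∀ x, x ≠ 0 → B x (T x) < 0)
    (hre : ∀ μ : ℂ, End.HasEigenvalue (T.baseChange ℂ) μ → 0 < μ.re) (x : W) (hx : x ≠ 0) :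
    B x x < 0 := by
  have hx' : (1 : ℂ) ⊗ₜ[ℝ] x ≠ 0 := (Module.FaithfullyFlat.one_tmul_eq_zero_iff ℝ W x).not.2 hx
  have := neg_of_apply_neg_of_re_pos (complexify_symm hs) B.complexify_I_smul
    (complexify_apply_baseChange_neg hT) hre ((1 : ℂ) ⊗ₜ[ℝ] x) hx'
  simpa [complexify_tmul] using this

lemma LinearMap.BilinForm.re_ne_zero_of_hasEigenvalue_baseChange
    {B : LinearMap.BilinForm ℝ W} (hs : ∀ x y, B x y = B y x) {T : End ℝ W}
    (hT : ∀ x, x ≠ 0 → B x (T x) < 0) {μ : ℂ}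
    (hμ : End.HasEigenvalue (T.baseChange ℂ) μ) : μ.re ≠ 0 := by
  intro h0
  obtain ⟨v, hv⟩ := hμ.exists_hasEigenvector
  have h₁ := complexify_apply_baseChange_neg hT v hv.2
  rw [apply_eigenvector (complexify_symm hs) B.complexify_I_smul hv, h0, zero_mul] at h₁
  exact h₁.false

lemma aeval_eq_zero_of_hasEigenvalue_baseChange {T : End ℝ W} {p : ℝ[X]} (hp : aeval T p = 0)
    {μ : ℂ} (hμ : End.HasEigenvalue (T.baseChange ℂ) μ) : aeval μ p = 0 := by
  obtain ⟨v, hv⟩ := hμ.exists_hasEigenvector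
  have h₁ : aeval (T.baseChange ℂ) p = 0 := by
    have := aeval_algHom_apply (End.baseChangeHom ℝ ℂ W) T p
    rw [hp, map_zero] at this
    exact this
  have h₂ := End.aeval_apply_of_hasEigenvector (p := p.map (algebraMap ℝ ℂ)) hv
  rw [aeval_map_algebraMap, h₁, LinearMap.zero_apply, eval_map_algebraMap] at h₂
  exact (smul_eq_zero.1 h₂.symm).resolve_right hv.2

lemma LinearMap.BilinForm.re_ne_zero_of_aeval_charpoly_eq_zero [FiniteDimensional ℝ W]
    {B : LinearMap.BilinForm ℝ W} (hs : ∀ x y, B x y = B y x) {T : End ℝ W}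
    (hT : ∀ x, x ≠ 0 → B x (T x) < 0) {μ : ℂ} (hμ : aeval μ T.charpoly = 0) : μ.re ≠ 0 := by
  refine B.re_ne_zero_of_hasEigenvalue_baseChange hs hT (μ := μ) ?_
  rwa [End.hasEigenvalue_iff_isRoot_charpoly, LinearMap.charpoly_baseChange, IsRoot.def,
    eval_map_algebraMap]

/-- Lyapunov's theorem for a real symmetric bilinear form and an endomorphism whose spectrum lies
in the open left half-plane. -/
theorem LinearMap.BilinForm.pos_of_apply_neg_of_baseChange_re_neg [FiniteDimensional ℝ W]
    {B : LinearMap.BilinForm ℝ W} (hs : ∀ x y, B x y = B y x) {T : End ℝ W}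
    (hT : ∀ x, x ≠ 0 → B x (T x) < 0)
    (hre : ∀ μ : ℂ, End.HasEigenvalue (T.baseChange ℂ) μ → μ.re < 0) (x : W) (hx : x ≠ 0) :
    0 < B x x := by
  have hneg : (-B) x x < 0 := by
    refine neg_of_apply_neg_of_baseChange_re_pos (B := -B) (T := -T) ?_ ?_ ?_ x hx
    · intro x y
      simp [hs x y]
    · intro y hy
      simpa using hT y hy
    · intro μ hμ
      obtain ⟨v, hv⟩ := hμ.exists_hasEigenvector
      have hv' : End.HasEigenvector (T.baseChange ℂ) (-μ) v := by
        refine End.hasEigenvector_iff.2 ⟨End.mem_eigenspace_iff.2 ?_, hv.2⟩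
        rw [neg_smul, ← hv.apply_eq_smul, LinearMap.baseChange_neg, LinearMap.neg_apply, neg_neg]
      simpa using hre (-μ) (End.hasEigenvalue_of_hasEigenvector hv')
  simpa using hneg

end Complexification

section RealPolynomials

/-- All complex roots of an irreducible real polynomial have the same real part. -/
lemma Irreducible.re_eq_re_of_aeval_eq_zero {q : ℝ[X]} (hq : Irreducible q) {z w : ℂ}
    (hz : aeval z q = 0) (hw : aeval w q = 0) : w.re = z.re := by
  have hroot {d : ℝ[X]} (hd : ¬IsUnit d) (hdq : d ∣ q) : aeval w d = 0 :=
    aeval_eq_zero_of_dvd_aeval_eq_zero ((hq.dvd_iff.1 hdq).resolve_left hd).dvd hw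
  by_cases him : z.im = 0
  · have hzr : z = algebraMap ℝ ℂ z.re := Complex.ext rfl (by simpa using him)
    have hdvd : X - C z.re ∣ q := by
      rw [hzr, aeval_algebraMap_apply, map_eq_zero, coe_aeval_eq_eval] at hz
      exact dvd_iff_isRoot.2 hz
    have h₁ := hroot (not_isUnit_X_sub_C z.re) hdvd
    rw [map_sub, aeval_X, aeval_C, sub_eq_zero] at h₁
    rw [h₁]
    simp
  · have hdeg : (X ^ 2 - C (2 * z.re) * X + C (‖z‖ ^ 2)).natDegree = 2 := by
      compute_degree!
    have h₁ := hroot (not_isUnit_of_natDegree_pos _ (by lia))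
      (q.quadratic_dvd_of_aeval_eq_zero_im_ne_zero hz him)
    have h₂ : (w - (starRingEnd ℂ) z) * (w - z) = 0 := by
      have h₃ := Complex.add_conj z
      have h₄ := Complex.mul_conj' z
      simp only [map_add, map_sub, map_mul, map_pow, aeval_X, aeval_C, Complex.coe_algebraMap,
        map_ofNat] at h₁
      push_cast at h₃
      linear_combination h₁ - w * h₃ + h₄
    rcases mul_eq_zero.1 h₂ with h₃ | h₃
    · rw [sub_eq_zero.1 h₃, Complex.conj_re]
    · rw [sub_eq_zero.1 h₃]

/-- A real polynomial without roots on the imaginary axis factors into a polynomial with roots in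
the right half-plane and one with roots in the left half-plane. -/
lemma Polynomial.exists_mul_eq_re_pos_re_neg (f : ℝ[X]) (hf : ∀ z : ℂ, aeval z f = 0 → z.re ≠ 0) :
    ∃ p n : ℝ[X], p * n = f ∧ (∀ z : ℂ, aeval z p = 0 → 0 < z.re) ∧
      ∀ z : ℂ, aeval z n = 0 → z.re < 0 := by
  induction f using UniqueFactorizationMonoid.induction_on_prime with
  | h₁ => exact absurd rfl (hf 0 (by simp))
  | h₂ u hu =>
    exact ⟨u, 1, mul_one u, fun z hz ↦ absurd hz (hu.map (aeval z)).ne_zero, by simp⟩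
  | h₃ a q ha hq ih =>
    obtain ⟨p, n, rfl, hp, hn⟩ := ih fun z hz ↦ hf z (by simp [hz])
    obtain ⟨z, hz⟩ := IsAlgClosed.exists_aeval_eq_zero ℂ q hq.irreducible.degree_pos.ne'
    have hre (w : ℂ) (hw : aeval w q = 0) : w.re = z.re :=
      hq.irreducible.re_eq_re_of_aeval_eq_zero hz hw
    rcases (hf z (by simp [hz])).lt_or_gt with hlt | hgt
    · refine ⟨p, q * n, by ring, hp, fun w hw ↦ ?_⟩
      rw [map_mul, mul_eq_zero] at hw
      exact hw.elim (fun h ↦ (hre w h).trans_lt hlt) (hn w)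
    · refine ⟨q * p, n, by ring, fun w hw ↦ ?_, hn⟩
      rw [map_mul, mul_eq_zero] at hw
      exact hw.elim (fun h ↦ hgt.trans_eq (hre w h).symm) (hp w)

end RealPolynomials

section Restriction

variable {R M : Type*} [CommRing R] [AddCommGroup M] [Module R M]

lemma coe_aeval_restrict_apply {f : End R M} {U : Submodule R M} (hU : ∀ x ∈ U, f x ∈ U)
    (p : R[X]) (x : U) : (aeval (f.restrict hU) p x : M) = aeval f p x := by
  induction p using Polynomial.induction_on' with
  | add p q hp hq => simp [hp, hq]
  | monomial n a => simp [aeval_monomial, Module.End.pow_restrict n hU]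

lemma map_mem_ker_aeval (f : End R M) (p : R[X]) (x : M) (hx : x ∈ (aeval f p).ker) :
    f x ∈ (aeval f p).ker := by
  have h₁ : aeval f p * f = f * aeval f p := by
    simpa using congrArg (aeval f) (mul_comm p X)
  rw [LinearMap.mem_ker] at hx ⊢
  rw [← Module.End.mul_apply, h₁, Module.End.mul_apply, hx, map_zero]

lemma aeval_restrict_ker_aeval (f : End R M) (p : R[X]) :
    aeval (f.restrict (map_mem_ker_aeval f p)) p = 0 := by
  ext x
  rw [coe_aeval_restrict_apply]
  exact x.2

end Restriction

/-- Stable/unstable splitting of the linearization of an adapted pseudo-gradient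
(Section 2.1): if `DQ(x)[Ax] < 0` for all `x ≠ 0` (with
`DQ(x)[v] = polar Q (x,v)`), then `E = E⁺ ⊕ E⁻` with `A`-invariant summands,
the complexified restriction `A|E⁺` (resp. `A|E⁻`) has all eigenvalues of
positive (resp. negative) real part, `Q` is negative definite on `E⁺`, positive
definite on `E⁻`, and `dim E⁺` is the index of `Q` (the maximal dimension of a
subspace on which `Q` is negative definite). -/
theorem pseudo_gradient_stable_unstable_splitting (E : Type*) [AddCommGroup E]
    [Module ℝ E] [FiniteDimensional ℝ E] (Q : QuadraticForm ℝ E) (A : E →ₗ[ℝ] E)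
    (hneg : ∀ x : E, x ≠ 0 → Q.polarBilin x (A x) < 0) :
    ∃ (P N : Submodule ℝ E) (hP : ∀ x ∈ P, A x ∈ P) (hN : ∀ x ∈ N, A x ∈ N),
      IsCompl P N ∧
      (∀ μ : ℂ, Module.End.HasEigenvalue (LinearMap.baseChange ℂ (A.restrict hP)) μ →
        0 < μ.re) ∧
      (∀ μ : ℂ, Module.End.HasEigenvalue (LinearMap.baseChange ℂ (A.restrict hN)) μ →
        μ.re < 0) ∧
      (∀ x ∈ P, x ≠ 0 → Q x < 0) ∧
      (∀ x ∈ N, x ≠ 0 → 0 < Q x) ∧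
      IsGreatest {m : ℕ | ∃ p : Submodule ℝ E,
        finrank ℝ p = m ∧ ∀ x ∈ p, x ≠ 0 → Q x < 0} (finrank ℝ P) := by
  let B : LinearMap.BilinForm ℝ E := Q.polarBilin
  have hs (x y : E) : B x y = B y x := QuadraticMap.polar_comm Q x y
  have hBQ (x : E) : B x x = 2 * Q x := by
    rw [QuadraticMap.polarBilin_apply_apply, QuadraticMap.polar_self, nsmul_eq_mul, Nat.cast_ofNat]
  obtain ⟨p, n, hpn, hp, hn⟩ := exists_mul_eq_re_pos_re_neg A.charpoly fun _ hz ↦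
    B.re_ne_zero_of_aeval_charpoly_eq_zero hs hneg hz
  have hcop : IsCoprime p n := by
    refine (isCoprime_iff_aeval_ne_zero_of_isAlgClosed ℝ ℂ p n).2 fun z ↦ ?_
    by_contra! h
    exact lt_asymm (hp z h.1) (hn z h.2)
  have hcompl : IsCompl (aeval A p).ker (aeval A n).ker := by
    refine ⟨disjoint_ker_aeval_of_isCoprime A hcop, codisjoint_iff.2 ?_⟩
    rw [sup_ker_aeval_eq_ker_aeval_mul_of_coprime A hcop, hpn, LinearMap.aeval_self_charpoly,
      LinearMap.ker_zero]
  have hreP (μ : ℂ) (hμ : End.HasEigenvalue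
      (LinearMap.baseChange ℂ (A.restrict (map_mem_ker_aeval A p))) μ) : 0 < μ.re :=
    hp μ (aeval_eq_zero_of_hasEigenvalue_baseChange (aeval_restrict_ker_aeval A p) hμ)
  have hreN (μ : ℂ) (hμ : End.HasEigenvalue
      (LinearMap.baseChange ℂ (A.restrict (map_mem_ker_aeval A n))) μ) : μ.re < 0 :=
    hn μ (aeval_eq_zero_of_hasEigenvalue_baseChange (aeval_restrict_ker_aeval A n) hμ)
  have hQP (x : E) (hx : x ∈ (aeval A p).ker) (hx0 : x ≠ 0) : Q x < 0 := by
    have : B x x < 0 := LinearMap.BilinForm.neg_of_apply_neg_of_baseChange_re_pos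
      (B := B.restrict (aeval A p).ker) (fun y z ↦ hs y z)
      (fun y hy ↦ hneg y (by simpa using hy)) hreP ⟨x, hx⟩ (by simpa using hx0)
    linarith [hBQ x]
  have hQN (x : E) (hx : x ∈ (aeval A n).ker) (hx0 : x ≠ 0) : 0 < Q x := by
    have : 0 < B x x := LinearMap.BilinForm.pos_of_apply_neg_of_baseChange_re_neg
      (B := B.restrict (aeval A n).ker) (fun y z ↦ hs y z)
      (fun y hy ↦ hneg y (by simpa using hy)) hreN ⟨x, hx⟩ (by simpa using hx0)
    linarith [hBQ x]
  refine ⟨_, _, map_mem_ker_aeval A p, map_mem_ker_aeval A n, hcompl, hreP, hreN, hQP, hQN,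
    ⟨_, rfl, hQP⟩, ?_⟩
  rintro m ⟨U, rfl, hU⟩
  have hdisj : Disjoint U (aeval A n).ker := by
    refine Submodule.disjoint_def.2 fun x hxU hxN ↦ ?_
    by_contra hx0
    exact lt_asymm (hU x hxU hx0) (hQN x hxN hx0)
  have h₁ := Submodule.finrank_add_finrank_le_of_disjoint hdisj
  have h₂ := Submodule.finrank_add_eq_of_isCompl hcompl
  lia
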